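/- If R is a commutative nil-clean ring, then for every positive integer n the matrix ring Mₙ(R) is nil-clean. -/

import Mathlib

/-- An element of a ring is nil-clean if it is the sum of an idempotent and a nilpotent. -/
def IsNilCleanRing (R : Type*) [Ring R] : Prop :=
  ∀ a : R, ∃ e n : R, IsIdempotentElem e ∧ IsNilpotent n ∧ a = e + n

def NC {R : Type*} [Ring R] (a : R) : Prop :=
  ∃ e n : R, IsIdempotentElem e ∧ IsNilpotent n ∧ a = e + n

theorem nc_ext {F V : Type*} [Field F] [AddCommGroup V] [Module F V] (T : Module.End F V)
    (W : Submodule F V) (hW : ∀ x ∈ W, T x ∈ W) (h1 : NC (T.restrict hW))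
    (h2 : NC (W.mapQ W T hW : Module.End F (V ⧸ W))) : NC T := by
  obtain ⟨e1, n1, he1, ⟨k1, hn1⟩, h1⟩ := h1
  obtain ⟨e2, n2, he2, ⟨k2, hn2⟩, h2⟩ := h2
  obtain ⟨s, hs⟩ := W.mkQ.exists_rightInverse_of_surjective (Submodule.range_mkQ W)
  have hs' : ∀ y, W.mkQ (s y) = y := fun y => by
    simpa using congrArg (fun f => f y) hs
  have hp : ∀ x, x - s (W.mkQ x) ∈ W := fun x => by
    have : W.mkQ (x - s (W.mkQ x)) = 0 := by rw [map_sub, hs', sub_self]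
    simpa only [Submodule.mkQ_apply, Submodule.Quotient.mk_eq_zero] using this
  let p : V →ₗ[F] W := LinearMap.codRestrict W (LinearMap.id - s ∘ₗ W.mkQ) hp
  have hpv : ∀ x, (p x : V) = x - s (W.mkQ x) := fun x => rfl
  have hq : ∀ w : W, W.mkQ (w : V) = 0 := fun w => by simp
  have hpw : ∀ w : W, p w = w := fun w => by
    apply Subtype.ext; rw [hpv, hq]; simp
  have hps : ∀ y, p (s y) = 0 := fun y => by
    apply Subtype.ext; rw [hpv, hs']; simp
  have he1' : ∀ w, e1 (e1 w) = e1 w := fun w => congrArg (fun f => f w) he1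
  have he2' : ∀ w, e2 (e2 w) = e2 w := fun w => congrArg (fun f => f w) he2
  let e : Module.End F V := W.subtype ∘ₗ e1 ∘ₗ p + s ∘ₗ e2 ∘ₗ W.mkQ
  have hev : ∀ x, e x = (e1 (p x) : V) + s (e2 (W.mkQ x)) := fun x => rfl
  have hN1 : ∀ w : W, (T - e) w = (n1 w : V) := fun w => by
    have := congrArg (fun f => ((f w : W) : V)) h1
    simp only [LinearMap.coe_restrict_apply, LinearMap.add_apply, Submodule.coe_add] at this
    rw [LinearMap.sub_apply, hev, hpw, hq, this]; simp
  have hN2 : ∀ x : V, W.mkQ ((T - e) x) = n2 (W.mkQ x) := fun x => by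
    have := congrArg (fun f => f (W.mkQ x)) h2
    simp only [LinearMap.add_apply] at this
    have h3 : W.mapQ W T hW (W.mkQ x) = W.mkQ (T x) := rfl
    rw [h3] at this
    rw [LinearMap.sub_apply, map_sub, this, hev, map_add, hq, hs']; simp
  have hN1k : ∀ k, ∀ w : W, ((T - e) ^ k) w = ((n1 ^ k) w : V) := fun k => by
    induction k with
    | zero => intro w; simp
    | succ k ih => intro w; rw [pow_succ, Module.End.mul_apply, hN1, ih, pow_succ, Module.End.mul_apply]
  have hN2k : ∀ k, ∀ x : V, W.mkQ (((T - e) ^ k) x) = (n2 ^ k) (W.mkQ x) := fun k => by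
    induction k with
    | zero => intro w; simp
    | succ k ih => intro w; rw [pow_succ, Module.End.mul_apply, ih, hN2, pow_succ, Module.End.mul_apply]
  refine ⟨e, T - e, ?_, ⟨k1 + k2, ?_⟩, by abel⟩
  · apply LinearMap.ext; intro x
    rw [Module.End.mul_apply, hev (e x), hev x]
    simp only [map_add, hpw, hps, hq, hs', he1', he2', add_zero, zero_add]
  · apply LinearMap.ext; intro x
    have h4 : ((T - e) ^ k2) x ∈ W := by
      have : W.mkQ (((T - e) ^ k2) x) = 0 := by rw [hN2k, hn2]; rfl
      simpa only [Submodule.mkQ_apply, Submodule.Quotient.mk_eq_zero] using this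
    rw [pow_add, Module.End.mul_apply]
    have := hN1k k1 ⟨_, h4⟩
    rw [hn1] at this
    simpa using this

theorem nil_of_entries {R : Type*} [CommRing R] {n : ℕ} (M : Matrix (Fin n) (Fin n) R)
    (h : ∀ i j, IsNilpotent (M i j)) : IsNilpotent M := by
  let I : Ideal R := Ideal.span (Set.range (fun p : Fin n × Fin n => M p.1 p.2))
  have hfg : I.FG := Submodule.fg_span (Set.finite_range _)
  have hI : I ≤ nilradical R := by
    rw [Ideal.span_le]; rintro _ ⟨p, rfl⟩; exact h _ _
  obtain ⟨k, hk⟩ := (Ideal.FG.isNilpotent_iff_le_nilradical hfg).2 hI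
  have : ∀ m, ∀ i j, (M ^ m) i j ∈ I ^ m := by
    intro m
    induction m with
    | zero => simp
    | succ m ih =>
      intro i j
      rw [pow_succ M, Matrix.mul_apply, pow_succ]
      exact Ideal.sum_mem _ fun l _ => Ideal.mul_mem_mul (ih _ _) (Ideal.subset_span ⟨(l, j), rfl⟩)
  refine ⟨k, ?_⟩
  ext i j
  have := this k i j
  rw [hk] at this
  simpa using this

theorem main_lift {R : Type*} [CommRing R] {n : ℕ}
    (h : IsNilCleanRing (Matrix (Fin n) (Fin n) (R ⧸ nilradical R))) :
    IsNilCleanRing (Matrix (Fin n) (Fin n) R) := by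
  intro M
  let f := (Ideal.Quotient.mk (nilradical R)).mapMatrix (m := Fin n)
  have hker : ∀ x ∈ RingHom.ker f, IsNilpotent x := by
    intro x hx
    apply nil_of_entries
    intro i j
    have h0 : f x = 0 := hx
    have := congrFun (congrFun h0 i) j
    rw [← mem_nilradical]
    exact Ideal.Quotient.eq_zero_iff_mem.1 this
  have hsurj : Function.Surjective f := by
    intro y
    choose g hg using fun i j => Ideal.Quotient.mk_surjective (y i j)
    exact ⟨Matrix.of g, by ext i j; exact hg i j⟩
  obtain ⟨e, m, he, ⟨k, hm⟩, hM⟩ := h (f M)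
  obtain ⟨e', he', hee⟩ := exists_isIdempotentElem_eq_of_ker_isNilpotent f hker e (hsurj e) he
  refine ⟨e', M - e', he', ?_, by abel⟩
  have : f (M - e') = m := by rw [map_sub, hee, hM]; abel
  obtain ⟨l, hl⟩ := hker ((M - e') ^ k) (by rw [RingHom.mem_ker, map_pow, this, hm])
  exact ⟨k * l, by rw [pow_mul, hl]⟩

theorem bool_case {B : Type*} [CommRing B] (hB : ∀ a : B, a * a = a) {n : ℕ}
    (h : IsNilCleanRing (Matrix (Fin n) (Fin n) (ZMod 2))) :
    IsNilCleanRing (Matrix (Fin n) (Fin n) B) := by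
  intro A
  rcases subsingleton_or_nontrivial B with hs | hs
  · exact ⟨0, 0, IsIdempotentElem.zero, IsNilpotent.zero, Subsingleton.elim _ _⟩
  have h2 : (2 : B) = 0 := by linear_combination hB 2
  have : CharP B 2 := CharTwo.of_one_ne_zero_of_two_eq_zero one_ne_zero h2
  let c : ZMod 2 →+* B := ZMod.castHom (dvd_refl 2) B
  let X := Fin n × Fin n → ZMod 2
  let t : Fin n × Fin n → ZMod 2 → B := fun p z => if z = 0 then 1 - A p.1 p.2 else A p.1 p.2
  have ht : ∀ p z, A p.1 p.2 * t p z = c z * t p z := by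
    intro p z
    have hz : z = 0 ∨ z = 1 := by revert z; decide
    have := hB (A p.1 p.2)
    rcases hz with rfl | rfl
    · simp [t, mul_sub, this]
    · simp [t, this]
  have ht2 : ∀ p z z', z ≠ z' → t p z * t p z' = 0 := by
    intro p z z' hzz
    have hz : (z = 0 ∧ z' = 1) ∨ (z = 1 ∧ z' = 0) := by revert z z'; decide
    have := hB (A p.1 p.2)
    rcases hz with ⟨rfl, rfl⟩ | ⟨rfl, rfl⟩ <;> simp [t, mul_sub, sub_mul, this]
  let ε : X → B := fun g => ∏ p, t p (g p)
  have hid : ∀ g, ε g * ε g = ε g := fun g => hB _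
  have hA : ∀ p g, A p.1 p.2 * ε g = c (g p) * ε g := by
    intro p g
    simp only [ε]
    rw [← Finset.mul_prod_erase _ _ (Finset.mem_univ p), ← mul_assoc, ht, mul_assoc]
  have horth : ∀ g g', g ≠ g' → ε g * ε g' = 0 := by
    intro g g' hg
    obtain ⟨p, hp⟩ := Function.ne_iff.1 hg
    simp only [ε]
    rw [← Finset.prod_mul_distrib]
    exact Finset.prod_eq_zero (Finset.mem_univ p) (ht2 p _ _ hp)
  have hsum : ∑ g, ε g = 1 := by
    have := Finset.prod_univ_sum (fun _ : Fin n × Fin n => (Finset.univ : Finset (ZMod 2))) t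
    rw [Fintype.piFinset_univ] at this
    simp only [ε]
    rw [← this]
    apply Finset.prod_eq_one
    intro p _
    have : (Finset.univ : Finset (ZMod 2)) = {0, 1} := by decide
    rw [this, Finset.sum_pair (by decide)]
    simp [t]
  let φ : (X → ZMod 2) →+* B :=
    { toFun := fun f => ∑ g, c (f g) * ε g
      map_one' := by simp [hsum]
      map_zero' := by simp
      map_add' := by intro f f'; simp [add_mul, Finset.sum_add_distrib]
      map_mul' := by
        intro f f'
        rw [Finset.sum_mul_sum]
        refine Finset.sum_congr rfl fun g _ => ?_
        rw [Finset.sum_eq_single g]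
        · rw [Pi.mul_apply, map_mul]; linear_combination (-c (f g) * c (f' g)) * hid g
        · intro b _ hb
          linear_combination (c (f g) * c (f' b)) * horth g b hb.symm
        · simp }
  choose E N hE hN hEN using fun g : X => h (Matrix.of fun i j => g (i, j))
  choose k hk using hN
  let Φ := φ.mapMatrix (m := Fin n)
  let E' : Matrix (Fin n) (Fin n) (X → ZMod 2) := Matrix.of fun i j g => E g i j
  let N' : Matrix (Fin n) (Fin n) (X → ZMod 2) := Matrix.of fun i j g => N g i j
  let ev : ∀ g : X, Matrix (Fin n) (Fin n) (X → ZMod 2) →+* Matrix (Fin n) (Fin n) (ZMod 2) :=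
    fun g => (Pi.evalRingHom (fun _ : X => ZMod 2) g).mapMatrix
  have hev : ∀ P Q, (∀ g, ev g P = ev g Q) → P = Q := by
    intro P Q hPQ
    ext i j g
    exact congrFun (congrFun (hPQ g) i) j
  have e1 : ∀ g, ev g E' = E g := fun g => rfl
  have e2 : ∀ g, ev g N' = N g := fun g => rfl
  refine ⟨Φ E', Φ N', ?_, ?_, ?_⟩
  · have : E' * E' = E' := hev _ _ fun g => by rw [map_mul, e1]; exact hE g
    show _ * _ = _
    rw [← map_mul, this]
  · refine IsNilpotent.map ⟨∑ g, k g, ?_⟩ Φ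
    refine hev _ _ fun g => ?_
    rw [map_pow, e2, map_zero]
    exact pow_eq_zero_of_le (Finset.single_le_sum (fun _ _ => Nat.zero_le _) (Finset.mem_univ g)) (hk g)
  · rw [← map_add]
    have : E' + N' = Matrix.of fun i j g => g (i, j) := hev _ _ fun g => by
      rw [map_add, e1, e2, ← hEN]; rfl
    rw [this]
    ext i j
    show A i j = ∑ g, c (g (i, j)) * ε g
    rw [← mul_one (A i j), ← hsum, Finset.mul_sum]
    exact Finset.sum_congr rfl fun g _ => hA (i, j) g

theorem nc_cyc {V : Type*} [AddCommGroup V] [Module (ZMod 2) V] (T : Module.End (ZMod 2) V)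
    (n : ℕ) (v : ℕ → V) (hv : ∀ i, T (v i) = v (i + 1)) (b : Module.Basis (Fin n) (ZMod 2) V)
    (hb : ∀ i, b i = v i) : NC T := by
  have key : ∀ N : Module.End (ZMod 2) V, (∀ i < n, ∃ k, (N ^ k) (v i) = 0) → IsNilpotent N := by
    intro N hN
    choose! k hk using hN
    refine ⟨∑ i : Fin n, k i, b.ext fun i => ?_⟩
    have hle : k i ≤ ∑ i : Fin n, k i :=
      Finset.single_le_sum (f := fun i : Fin n => k i) (fun _ _ => Nat.zero_le _) (Finset.mem_univ i)
    obtain ⟨d, hd⟩ := Nat.exists_eq_add_of_le' hle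
    rw [hd, pow_add, Module.End.mul_apply, hb, hk i i.2]; simp
  have hvn : v n = ∑ i, b.repr (v n) i • v i := by
    conv_lhs => rw [← b.sum_repr (v n)]
    simp only [hb]
  set c := b.repr (v n) with hc
  by_cases hc0 : ∀ i, c i = 0
  · refine ⟨0, T, IsIdempotentElem.zero, key T fun i hi => ⟨n - i, ?_⟩, by simp⟩
    have hT : ∀ k i, (T ^ k) (v i) = v (i + k) := by
      intro k
      induction k with
      | zero => simp
      | succ k ih => intro i; rw [pow_succ, Module.End.mul_apply, hv, ih]; congr 1; omega
    rw [hT, show i + (n - i) = n by omega, hvn]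
    simp [hc0]
  push Not at hc0
  obtain ⟨j, g, hj, hg, hvg⟩ : ∃ (j : ℕ) (g : V), j < n ∧
      g ∈ Submodule.span (ZMod 2) (v '' {i | i < j}) ∧ v n = v j + g := by
    obtain ⟨i0, hi0⟩ := hc0
    obtain ⟨j, hj, hmax⟩ := Finset.exists_max_image (Finset.univ.filter fun i => c i ≠ 0) (fun i => (i : ℕ))
      ⟨i0, by simp [hi0]⟩
    simp only [Finset.mem_filter, Finset.mem_univ, true_and] at hj hmax
    have hj1 : c j = 1 := by
      have : ∀ z : ZMod 2, z ≠ 0 → z = 1 := by decide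
      exact this _ hj
    refine ⟨j, ∑ i ∈ Finset.univ.erase j, c i • v i, j.2, ?_, ?_⟩
    · refine Submodule.sum_mem _ fun i hi => ?_
      by_cases h0 : c i = 0
      · simp [h0]
      · refine Submodule.smul_mem _ _ (Submodule.subset_span ⟨i, ?_, rfl⟩)
        have h1 := hmax i h0
        have h2 : (i : ℕ) ≠ j := fun h => (Finset.ne_of_mem_erase hi) (Fin.ext h)
        simp only [Set.mem_ofPred_eq]; omega
    · rw [hvn, ← Finset.add_sum_erase _ _ (Finset.mem_univ j), hj1, one_smul]
  let E : Module.End (ZMod 2) V := b.constr ℕ fun i =>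
    if (i : ℕ) < j then 0 else if (i : ℕ) + 1 = n then v i + g else v j
  have hE : ∀ i < n, E (v i) = if i < j then 0 else if i + 1 = n then v i + g else v j := by
    intro i hi
    have := b.constr_basis ℕ (fun i : Fin n =>
      if (i : ℕ) < j then 0 else if (i : ℕ) + 1 = n then v i + g else v j) ⟨i, hi⟩
    rw [hb] at this
    exact this
  have hE1 : ∀ i < j, E (v i) = 0 := fun i hi => by rw [hE i (hi.trans hj), if_pos hi]
  have hE2 : ∀ i, i + 1 = n → E (v i) = v i + g := fun i hi => by
    rw [hE i (by omega), if_neg (by omega), if_pos hi]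
  have hE3 : ∀ i, j ≤ i → i + 1 < n → E (v i) = v j := fun i hi hi' => by
    rw [hE i (by omega), if_neg (by omega), if_neg (by omega)]
  have hEg : E g = 0 := by
    have : Submodule.span (ZMod 2) (v '' {i | i < j}) ≤ LinearMap.ker E := by
      rw [Submodule.span_le]; rintro _ ⟨i, hi, rfl⟩; exact hE1 i hi
    exact this hg
  have hidem : IsIdempotentElem E := by
    refine b.ext fun i => ?_
    rw [Module.End.mul_apply, hb]
    have hi := i.2
    rcases lt_or_ge (i : ℕ) j with h | h
    · rw [hE1 _ h, map_zero]
    · by_cases h' : (i : ℕ) + 1 = n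
      · rw [hE2 _ h', map_add, hE2 _ h', hEg, add_zero]
      · rw [hE3 i h (by omega), hE3 j le_rfl (by omega)]
  refine ⟨E, T - E, hidem, key _ ?_, by abel⟩
  let P : V → Prop := fun x => ∃ k, ((T - E) ^ k) x = 0
  have hP0 : P 0 := ⟨0, by simp⟩
  have hPs : ∀ x, P ((T - E) x) → P x := fun x ⟨k, hk⟩ =>
    ⟨k + 1, by rw [pow_succ, Module.End.mul_apply, hk]⟩
  have hPa : ∀ x y, P x → P y → P (x + y) := fun x y ⟨k, hk⟩ ⟨l, hl⟩ => by
    refine ⟨k + l, ?_⟩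
    have h1 : ((T - E) ^ (k + l)) x = 0 := by
      rw [add_comm, pow_add, Module.End.mul_apply, hk, map_zero]
    have h2 : ((T - E) ^ (k + l)) y = 0 := by
      rw [pow_add, Module.End.mul_apply, hl, map_zero]
    rw [map_add, h1, h2, add_zero]
  have hN1 : ∀ i < j, (T - E) (v i) = v (i + 1) := fun i hi => by
    rw [LinearMap.sub_apply, hv, hE1 i hi, sub_zero]
  have hN2 : ∀ i, i + 1 = n → (T - E) (v i) = v j - v i := fun i hi => by
    rw [LinearMap.sub_apply, hv, hE2 i hi, hi, hvg]; abel
  have hN3 : ∀ i, j ≤ i → i + 1 < n → (T - E) (v i) = v (i + 1) - v j := fun i hi hi' => by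
    rw [LinearMap.sub_apply, hv, hE3 i hi hi']
  have hdiff : ∀ d i, i + 2 + d = n → j ≤ i → P (v (i + 1) - v i) := by
    intro d
    induction d with
    | zero =>
      intro i hi hji
      apply hPs
      rw [map_sub, hN2 (i + 1) (by omega), hN3 i hji (by omega)]
      have h2 : ∀ x : V, x + x = 0 := fun x => by
        rw [← two_smul (ZMod 2) x, show (2 : ZMod 2) = 0 from rfl, zero_smul]
      have : v j - v (i + 1) - (v (i + 1) - v j) = (v j + v j) - (v (i + 1) + v (i + 1)) := by abel
      rw [this, h2, h2, sub_zero]; exact hP0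
    | succ d ih =>
      intro i hi hji
      apply hPs
      rw [map_sub, hN3 (i + 1) (by omega) (by omega), hN3 i hji (by omega), sub_sub_sub_cancel_right]
      exact ih (i + 1) (by omega) (by omega)
  have hPj : P (v j) := by
    apply hPs
    by_cases h : j + 1 = n
    · rw [hN2 j h, sub_self]; exact hP0
    · rw [hN3 j le_rfl (by omega)]
      exact hdiff (n - (j + 2)) j (by omega) le_rfl
  have hPu : ∀ d, j + d < n → P (v (j + d)) := by
    intro d
    induction d with
    | zero => intro _; exact hPj
    | succ d ih =>
      intro hd
      have := hPa _ _ (hdiff (n - (j + d + 2)) (j + d) (by omega) (by omega)) (ih (by omega))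
      rwa [sub_add_cancel] at this
  have hPd : ∀ d i, i + d = j → P (v i) := by
    intro d
    induction d with
    | zero => intro i hi; obtain rfl : i = j := by omega
              exact hPj
    | succ d ih =>
      intro i hi
      apply hPs
      rw [hN1 i (by omega)]
      exact ih _ (by omega)
  intro i hi
  rcases lt_or_ge i j with h | h
  · exact hPd (j - i) i (by omega)
  · have := hPu (i - j) (by omega)
    rwa [show j + (i - j) = i by omega] at this

theorem nc_end : ∀ (d : ℕ) (V : Type) [AddCommGroup V] [Module (ZMod 2) V]
    [FiniteDimensional (ZMod 2) V] (T : Module.End (ZMod 2) V),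
    Module.finrank (ZMod 2) V = d → NC T := by
  intro d
  induction d using Nat.strong_induction_on with
  | _ d ih =>
  intro V _ _ _ T hd
  rcases subsingleton_or_nontrivial V with hs | hs
  · exact ⟨0, 0, IsIdempotentElem.zero, IsNilpotent.zero, Subsingleton.elim _ _⟩
  obtain ⟨x, hx⟩ := exists_ne (0 : V)
  let v : ℕ → V := fun i => (T ^ i) x
  have hv : ∀ i, T (v i) = v (i + 1) := fun i => by
    simp only [v]; rw [pow_succ', Module.End.mul_apply]
  let L : ℕ → Prop := fun n => LinearIndependent (ZMod 2) (fun i : Fin n => v i)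
  have hLb : ∀ n, L n → n ≤ d := fun n hn => by
    have := hn.fintype_card_le_finrank
    simpa [hd] using this
  classical
  have hex : ∃ n, ¬ L n := ⟨d + 1, fun h => by have := hLb _ h; omega⟩
  obtain ⟨n, hn, hn'⟩ : ∃ n, L n ∧ ¬ L (n + 1) := by
    by_contra! hcon
    obtain ⟨n, hn⟩ := hex
    apply hn
    induction n with
    | zero => exact linearIndependent_empty_type
    | succ n ih => exact hcon n (by by_contra h; exact h (ih h))
  have hmem : v n ∈ Submodule.span (ZMod 2) (Set.range fun i : Fin n => v i) := by
    by_contra h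
    apply hn'
    refine linearIndependent_finSucc'.2 ⟨?_, ?_⟩
    · exact hn
    · exact h
  set W := Submodule.span (ZMod 2) (Set.range fun i : Fin n => v i) with hWdef
  have hvW : ∀ i ≤ n, v i ∈ W := by
    intro i hi
    rcases hi.lt_or_eq with h | rfl
    · exact Submodule.subset_span ⟨⟨i, h⟩, rfl⟩
    · exact hmem
  have hW : ∀ y ∈ W, T y ∈ W := by
    have : W ≤ W.comap T := by
      conv_lhs => rw [hWdef]
      rw [Submodule.span_le]
      rintro _ ⟨i, rfl⟩
      show T (v i) ∈ W
      rw [hv]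
      exact hvW _ i.2
    exact this
  have hvW' : ∀ i, v i ∈ W := by
    intro i
    induction i with
    | zero => exact hvW 0 (Nat.zero_le _)
    | succ i ih => rw [← hv]; exact hW _ ih
  refine nc_ext T W hW ?_ ?_
  · refine nc_cyc _ n (fun i => ⟨v i, hvW' i⟩) (fun i => Subtype.ext (hv i)) (Module.Basis.span hn) ?_
    intro i
    exact Module.Basis.span_apply hn i
  · refine ih _ ?_ (V ⧸ W) _ rfl
    have h1 := Submodule.finrank_quotient_add_finrank W
    have h2 : 0 < Module.finrank (ZMod 2) W := by
      have : Nontrivial W := ⟨⟨⟨v 0, hvW' 0⟩, 0, fun h => hx (by simpa [v] using congrArg Subtype.val h)⟩⟩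
      exact Module.finrank_pos
    omega

theorem nc_zmod (n : ℕ) : IsNilCleanRing (Matrix (Fin n) (Fin n) (ZMod 2)) := by
  intro A
  obtain ⟨e, m, he, hm, h⟩ := nc_end _ (Fin n → ZMod 2) (Matrix.toLinAlgEquiv' A) rfl
  let f := (Matrix.toLinAlgEquiv' (R := ZMod 2) (n := Fin n)).symm
  refine ⟨f e, f m, he.map f, hm.map f, ?_⟩
  rw [← map_add, ← h]
  exact (AlgEquiv.symm_apply_apply _ _).symm

theorem matrix_nilClean_of_comm_nilClean (R : Type*) [CommRing R]
    (h : IsNilCleanRing R) (n : ℕ) (hn : 0 < n) :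
    IsNilCleanRing (Matrix (Fin n) (Fin n) R) := by
  refine main_lift (bool_case ?_ (nc_zmod n))
  intro a
  obtain ⟨a, rfl⟩ := Ideal.Quotient.mk_surjective a
  obtain ⟨e, m, he, hm, rfl⟩ := h a
  have : Ideal.Quotient.mk (nilradical R) m = 0 := Ideal.Quotient.eq_zero_iff_mem.2 hm
  rw [map_add, this, add_zero, ← map_mul, he.eq]
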